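/- Let k ≥ 0 be an integer and let t, t' be tapes with t(j) = t'(j) for all j ∈ {−k, …, k−1} and t(k) ≠ t'(k). Then |τ_k(e(t)) − τ_k(e(t'))| ≥ 3^{-(3k+2)}. Hence the encoded computation states with symbol 0 at the head and those with symbol 1 at the head are separated by a positive definite distance within each Cantor block, so the read operation is well defined with a positive margin. -/

import Mathlib

/-- A tape is a function `t : ℤ → {0,1}`. Its encoding is the real number
`e(t) := 2·∑_{n=0}^∞ t(n)·3^{-(2n+1)} + 2·∑_{n=1}^∞ t(−n)·3^{-2n}`. -/
noncomputable def tapeEnc (t : ℤ → Fin 2) : ℝ :=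
  2 * ∑' n : ℕ, ((t (n : ℤ) : ℕ) : ℝ) * (3 : ℝ)⁻¹ ^ (2 * n + 1)
    + 2 * ∑' n : ℕ, ((t (-((n : ℤ) + 1)) : ℕ) : ℝ) * (3 : ℝ)⁻¹ ^ (2 * (n + 1))

/-- For `k ∈ ℤ`, the affine map `τ_k : ℝ → ℝ`, given by `τ_k(x) := 3^{-(1−k)}·(1+x)`
if `k < 0` and `τ_k(x) := 1 + 3^{-(1+k)}·(x − 2)` if `k ≥ 0`. -/
noncomputable def tau (k : ℤ) (x : ℝ) : ℝ :=
  if k < 0 then (3 : ℝ) ^ (-(1 - k)) * (1 + x) else 1 + (3 : ℝ) ^ (-(1 + k)) * (x - 2)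

/-- Bounded digit sequences give summable base-`3` expansions. -/
theorem summable_mul_inv_three_pow {u : ℕ → ℝ} (hu : ∀ n, |u n| ≤ 1) (c : ℕ) :
    Summable fun n => u n * (3 : ℝ)⁻¹ ^ (2 * n + c) := by
  have hg : Summable fun n : ℕ => (9 : ℝ)⁻¹ ^ n * (3 : ℝ)⁻¹ ^ c :=
    (summable_geometric_of_lt_one (by norm_num) (by norm_num)).mul_right _
  refine Summable.of_norm_bounded hg fun n => ?_
  have h9 : (3 : ℝ)⁻¹ ^ (2 * n + c) = (9 : ℝ)⁻¹ ^ n * (3 : ℝ)⁻¹ ^ c := by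
    rw [pow_add, pow_mul]; norm_num
  rw [norm_mul, Real.norm_eq_abs, h9, Real.norm_of_nonneg (by positivity)]
  exact mul_le_of_le_one_left (by positivity) (hu n)

/-- A bounded digit sequence vanishing below index `m` has a small base-`3` expansion. -/
theorem abs_tsum_mul_inv_three_pow_le {u : ℕ → ℝ} (hu : ∀ n, |u n| ≤ 1) (c m : ℕ)
    (h0 : ∀ n < m, u n = 0) :
    |∑' n, u n * (3 : ℝ)⁻¹ ^ (2 * n + c)| ≤ 9 / 8 * (3 : ℝ)⁻¹ ^ (2 * m + c) := by
  have hsum : ∑ n ∈ Finset.range m, u n * (3 : ℝ)⁻¹ ^ (2 * n + c) = 0 :=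
    Finset.sum_eq_zero fun n hn => by rw [h0 n (Finset.mem_range.1 hn), zero_mul]
  rw [← (summable_mul_inv_three_pow hu c).sum_add_tsum_nat_add m, hsum, zero_add]
  have hg : HasSum (fun n : ℕ => (9 : ℝ)⁻¹ ^ n * (3 : ℝ)⁻¹ ^ (2 * m + c))
      (9 / 8 * (3 : ℝ)⁻¹ ^ (2 * m + c)) := by
    rw [show (9 / 8 : ℝ) = (1 - 9⁻¹)⁻¹ by norm_num]
    exact (hasSum_geometric_of_lt_one (by norm_num) (by norm_num)).mul_right _
  rw [← Real.norm_eq_abs]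
  refine tsum_of_norm_bounded hg fun n => ?_
  have h9 : (3 : ℝ)⁻¹ ^ (2 * (n + m) + c) = (9 : ℝ)⁻¹ ^ n * (3 : ℝ)⁻¹ ^ (2 * m + c) := by
    rw [show 2 * (n + m) + c = 2 * n + (2 * m + c) by ring, pow_add, pow_mul]; norm_num
  rw [norm_mul, Real.norm_eq_abs, h9, Real.norm_of_nonneg (by positivity)]
  exact mul_le_of_le_one_left (by positivity) (hu _)

theorem abs_fin_two_cast_le_one (a : Fin 2) : |((a : ℕ) : ℝ)| ≤ 1 := by
  fin_cases a <;> simp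

theorem abs_fin_two_cast_sub_le_one (a b : Fin 2) : |((a : ℕ) : ℝ) - ((b : ℕ) : ℝ)| ≤ 1 := by
  fin_cases a <;> fin_cases b <;> simp

theorem abs_fin_two_cast_sub_eq_one {a b : Fin 2} (h : a ≠ b) :
    |((a : ℕ) : ℝ) - ((b : ℕ) : ℝ)| = 1 := by
  fin_cases a <;> fin_cases b <;> simp_all

/-- The difference of two tape encodings, as a sum of digit differences. -/
theorem tapeEnc_sub (t t' : ℤ → Fin 2) :
    tapeEnc t - tapeEnc t' =
      2 * ((∑' n : ℕ, (((t n : ℕ) : ℝ) - ((t' n : ℕ) : ℝ)) * (3 : ℝ)⁻¹ ^ (2 * n + 1))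
        + ∑' n : ℕ, (((t (-((n : ℤ) + 1)) : ℕ) : ℝ) - ((t' (-((n : ℤ) + 1)) : ℕ) : ℝ)) *
          (3 : ℝ)⁻¹ ^ (2 * n + 2)) := by
  have hs (s : ℤ → Fin 2) (f : ℕ → ℤ) (c : ℕ) :
      Summable fun n => ((s (f n) : ℕ) : ℝ) * (3 : ℝ)⁻¹ ^ (2 * n + c) :=
    summable_mul_inv_three_pow (fun n => abs_fin_two_cast_le_one (s (f n))) c
  simp only [sub_mul]
  rw [(hs t (fun n => n) 1).tsum_sub (hs t' (fun n => n) 1),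
    (hs t (fun n => -((n : ℤ) + 1)) 2).tsum_sub (hs t' (fun n => -((n : ℤ) + 1)) 2)]
  simp only [tapeEnc, mul_add, mul_one]
  ring

/-- Tapes agreeing on `{-k, …, k-1}` and differing at `k` have separated encodings. -/
theorem inv_three_pow_le_abs_tapeEnc_sub (k : ℕ) (t t' : ℤ → Fin 2)
    (hj : ∀ j : ℤ, -k ≤ j → j ≤ k - 1 → t j = t' j) (h : t k ≠ t' k) :
    (3 : ℝ)⁻¹ ^ (2 * k + 1) ≤ |tapeEnc t - tapeEnc t'| := by
  rw [tapeEnc_sub]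
  set u : ℕ → ℝ := fun n => ((t n : ℕ) : ℝ) - ((t' n : ℕ) : ℝ) with hu
  set v : ℕ → ℝ := fun n =>
    ((t (-((n : ℤ) + 1)) : ℕ) : ℝ) - ((t' (-((n : ℤ) + 1)) : ℕ) : ℝ) with hv
  have hu1 : ∀ n, |u n| ≤ 1 := fun n => abs_fin_two_cast_sub_le_one _ _
  have hu0 : ∀ n < k, u n = 0 := fun n hn => by
    simp only [hu]; rw [hj n (by omega) (by omega), sub_self]
  have hV := abs_tsum_mul_inv_three_pow_le (u := v)
    (fun n => abs_fin_two_cast_sub_le_one _ _) 2 k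
    (fun n hn => by simp only [hv]; rw [hj _ (by omega) (by omega), sub_self])
  have hW := abs_tsum_mul_inv_three_pow_le (u := fun n => if n = k then 0 else u n)
    (fun n => by split_ifs <;> simp [hu1]) 1 (k + 1)
    (fun n hn => by
      split_ifs with hnk
      · rfl
      · exact hu0 n (by omega))
  have hU : ∑' n, u n * (3 : ℝ)⁻¹ ^ (2 * n + 1) = u k * (3 : ℝ)⁻¹ ^ (2 * k + 1) +
      ∑' n, (if n = k then 0 else u n) * (3 : ℝ)⁻¹ ^ (2 * n + 1) := by
    rw [(summable_mul_inv_three_pow hu1 1).tsum_eq_add_tsum_ite k]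
    simp only [ite_mul, zero_mul]
  have hk1 : |u k * (3 : ℝ)⁻¹ ^ (2 * k + 1)| = (3 : ℝ)⁻¹ ^ (2 * k + 1) := by
    rw [abs_mul, abs_fin_two_cast_sub_eq_one h, one_mul, abs_of_pos (by positivity)]
  change _ ≤ |2 * ((∑' n, u n * (3 : ℝ)⁻¹ ^ (2 * n + 1)) +
    ∑' n, v n * (3 : ℝ)⁻¹ ^ (2 * n + 2))|
  rw [hU, abs_mul, abs_two]
  rw [show 2 * (k + 1) + 1 = 2 * k + 1 + 2 by ring, pow_add _ _ 2] at hW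
  rw [show 2 * k + 2 = 2 * k + 1 + 1 by ring, pow_succ] at hV
  generalize (∑' n, (if n = k then 0 else u n) * (3 : ℝ)⁻¹ ^ (2 * n + 1)) = W at *
  generalize (∑' n, v n * (3 : ℝ)⁻¹ ^ (2 * n + 2)) = V at *
  have h1 := abs_sub_abs_le_abs_sub (u k * (3 : ℝ)⁻¹ ^ (2 * k + 1)) (-(W + V))
  rw [abs_neg, sub_neg_eq_add, ← add_assoc, hk1] at h1
  have h2 := abs_add_le W V
  linarith

/-- Let `k ≥ 0` be an integer and let `t, t'` be tapes with `t(j) = t'(j)` for all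
`j ∈ {−k, …, k−1}` and `t(k) ≠ t'(k)`. Then `|τ_k(e(t)) − τ_k(e(t'))| ≥ 3^{-(3k+2)}`:
the encoded computation states with symbol `0` at the head and those with symbol `1`
at the head are separated by a definite positive distance within each Cantor block. -/
theorem read_separation (k : ℤ) (hk : 0 ≤ k) (t t' : ℤ → Fin 2)
    (hj : ∀ j : ℤ, -k ≤ j → j ≤ k - 1 → t j = t' j) (h : t k ≠ t' k) :
    (3 : ℝ) ^ (-(3 * k + 2)) ≤ |tau k (tapeEnc t) - tau k (tapeEnc t')| := by
  obtain ⟨n, rfl⟩ := Int.eq_ofNat_of_zero_le hk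
  have hmain := inv_three_pow_le_abs_tapeEnc_sub n t t' hj h
  rw [tau, tau, if_neg hk.not_gt, if_neg hk.not_gt, add_sub_add_left_eq_sub, ← mul_sub,
    sub_sub_sub_cancel_right, abs_mul, abs_of_pos (zpow_pos (by norm_num) _)]
  have hpow : (3 : ℝ) ^ (-(3 * (n : ℤ) + 2)) =
      (3 : ℝ) ^ (-(1 + (n : ℤ))) * (3 : ℝ)⁻¹ ^ (2 * n + 1) := by
    rw [inv_pow, ← zpow_natCast, ← zpow_neg, ← zpow_add₀ (by norm_num)]
    congr 1
    push_cast
    ring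
  rw [hpow]
  gcongr
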